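/- Let d, m be positive integers, let ρ' and ρ be d×d positive definite Hermitian complex matrices with Tr ρ' = Tr ρ = 1, and let Q₁,…,Q_m be d×d Hermitian matrices with current vector Δq_u := Re Tr[(ρ'−ρ)Q_u] and covariance matrices V, V' as defined by the symmetrized second moments of the Q_u in ρ and ρ'. Assume V' = V, V positive definite, and suppose t > 0 satisfies D(ρ'‖ρ) ≤ F(t). Then the matrix inequality V − t⁻¹·Δq·Δqᵀ ⪰ 0 holds, i.e., V − t⁻¹ΔqΔqᵀ is positive semidefinite. -/

import Mathlib

open Matrix MeasureTheory
open scoped ComplexOrder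

/-- Matrix logarithm of a Hermitian positive definite matrix via the spectral
decomposition (continuous functional calculus); junk value `0` otherwise. -/
noncomputable def matLog {n : Type*} [Fintype n] [DecidableEq n]
    (A : Matrix n n ℂ) : Matrix n n ℂ :=
  if hA : A.IsHermitian then
    (hA.eigenvectorUnitary : Matrix n n ℂ) *
      Matrix.diagonal (fun i => (Real.log (hA.eigenvalues i) : ℂ)) *
      (star (hA.eigenvectorUnitary : Matrix n n ℂ))
  else 0

/-- Quantum relative entropy `D(ρ‖σ) = Re Tr[ρ (log ρ − log σ)]`. -/
noncomputable def qRelEnt {n : Type*} [Fintype n] [DecidableEq n]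
    (ρ σ : Matrix n n ℂ) : ℝ :=
  (Matrix.trace (ρ * (matLog ρ - matLog σ))).re

/-- Centered observable `Q − Re Tr(ρQ)·I`. -/
noncomputable def centered {n : Type*} [Fintype n] [DecidableEq n]
    (ρ Q : Matrix n n ℂ) : Matrix n n ℂ :=
  Q - (((Matrix.trace (ρ * Q)).re : ℝ) : ℂ) • 1

/-- Symmetrized covariance matrix
`V_{uv} = (1/2)·Re Tr[ρ {Q_u − ⟨Q_u⟩, Q_v − ⟨Q_v⟩}]` of the charges `Q` in state `ρ`. -/
noncomputable def covMatrix {n : Type*} [Fintype n] [DecidableEq n] {m : ℕ}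
    (ρ : Matrix n n ℂ) (Q : Fin m → Matrix n n ℂ) : Matrix (Fin m) (Fin m) ℝ :=
  Matrix.of fun u v =>
    (1 / 2) * (Matrix.trace (ρ * (centered ρ (Q u) * centered ρ (Q v) +
      centered ρ (Q v) * centered ρ (Q u)))).re


/-- `F(s) := ∫₀¹ λ s / (1 + λ(1−λ) s) dλ`. -/
noncomputable def Fbound (s : ℝ) : ℝ :=
  ∫ lam in (0:ℝ)..1, lam * s / (1 + lam * (1 - lam) * s)

lemma trace_conj_diagonal_mul {n : Type*} [Fintype n] [DecidableEq n] {U W : Matrix n n ℂ}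
    (hW : W * Wᴴ = 1) (f : n → ℂ) (M N : Matrix n n ℂ) :
    (U * diagonal f * Uᴴ * (M * N)).trace =
      ∑ i, ∑ j, f i * ((Uᴴ * M * W) i j * (Wᴴ * N * U) j i) := by
  have h1 : (U * diagonal f * Uᴴ * (M * N)).trace =
      (diagonal f * ((Uᴴ * M * W) * (Wᴴ * N * U))).trace := by
    have h2 : (Uᴴ * M * W) * (Wᴴ * N * U) = Uᴴ * M * (W * Wᴴ) * N * U := by
      simp only [Matrix.mul_assoc]
    rw [h2, hW, Matrix.mul_one, Matrix.mul_assoc U, Matrix.mul_assoc U, Matrix.trace_mul_comm U]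
    simp only [Matrix.mul_assoc]
  rw [h1]
  simp only [Matrix.trace, Matrix.diag_apply, Matrix.diagonal_mul,
    Matrix.mul_apply (M := Uᴴ * M * W), Finset.mul_sum]

lemma conjTranspose_mul_mul_apply {n : Type*} [Fintype n] {N : Matrix n n ℂ}
    (hN : N.IsHermitian) (U W : Matrix n n ℂ) (i j : n) :
    (Wᴴ * N * U) j i = star ((Uᴴ * N * W) i j) := by
  rw [← Matrix.conjTranspose_apply, Matrix.conjTranspose_mul, Matrix.conjTranspose_mul,
    Matrix.conjTranspose_conjTranspose, hN.eq, Matrix.mul_assoc]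

/-- The expectation of `M * N` in the state with eigenbasis `U`, expanded over pairs of eigenvectors
of `U` and `W`. -/
lemma re_trace_left {n : Type*} [Fintype n] [DecidableEq n] {U W : Matrix n n ℂ}
    (hW : W * Wᴴ = 1) (a : n → ℝ) (M : Matrix n n ℂ) {N : Matrix n n ℂ} (hN : N.IsHermitian) :
    (U * diagonal (fun i => (a i : ℂ)) * Uᴴ * (M * N)).trace.re =
      ∑ p : n × n, a p.1 * ((Uᴴ * M * W) p.1 p.2 * star ((Uᴴ * N * W) p.1 p.2)).re := by
  rw [trace_conj_diagonal_mul hW, Fintype.sum_prod_type]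
  simp only [Complex.re_sum, Complex.re_ofReal_mul]
  refine Finset.sum_congr rfl fun i _ => Finset.sum_congr rfl fun j _ => ?_
  rw [conjTranspose_mul_mul_apply hN]

/-- The expectation of `M * N` in the state with eigenbasis `W`, expanded over pairs of eigenvectors
of `U` and `W`. -/
lemma re_trace_right {n : Type*} [Fintype n] [DecidableEq n] {U W : Matrix n n ℂ}
    (hU : U * Uᴴ = 1) (b : n → ℝ) {M : Matrix n n ℂ} (hM : M.IsHermitian) (N : Matrix n n ℂ) :
    (W * diagonal (fun i => (b i : ℂ)) * Wᴴ * (M * N)).trace.re =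
      ∑ p : n × n, b p.2 * ((Uᴴ * N * W) p.1 p.2 * star ((Uᴴ * M * W) p.1 p.2)).re := by
  rw [trace_conj_diagonal_mul hU, Fintype.sum_prod_type_right]
  simp only [Complex.re_sum, Complex.re_ofReal_mul]
  refine Finset.sum_congr rfl fun j _ => Finset.sum_congr rfl fun i _ => ?_
  rw [conjTranspose_mul_mul_apply hM, mul_comm (star _)]

lemma matLog_eq {n : Type*} [Fintype n] [DecidableEq n] {A : Matrix n n ℂ} (hA : A.IsHermitian) :
    matLog A = (hA.eigenvectorUnitary : Matrix n n ℂ) *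
      diagonal (fun i => (Real.log (hA.eigenvalues i) : ℂ)) *
      (hA.eigenvectorUnitary : Matrix n n ℂ)ᴴ := by
  rw [matLog, dif_pos hA, star_eq_conjTranspose]

lemma spectral_decomposition {n : Type*} [Fintype n] [DecidableEq n] {A : Matrix n n ℂ}
    (hA : A.IsHermitian) :
    A = (hA.eigenvectorUnitary : Matrix n n ℂ) *
      diagonal (fun i => (hA.eigenvalues i : ℂ)) *
      (hA.eigenvectorUnitary : Matrix n n ℂ)ᴴ :=
  hA.spectral_theorem

lemma interpolation_pos {a b l : ℝ} (ha : 0 < a) (hb : 0 < b) (hl : l ∈ Set.Icc (0 : ℝ) 1) :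
    0 < a + l * (b - a) := by
  rcases hl.1.eq_or_lt with rfl | h
  · simpa using ha
  · nlinarith [mul_pos h hb, mul_nonneg (sub_nonneg.2 hl.2) ha.le]

/-- Real expansion of a pair of positive definite matrices over the joint distribution of their
eigenbases: the relative entropy, and the Cauchy–Schwarz inequality for any observable. -/
lemma exists_joint_distribution {n : Type*} [Fintype n] [DecidableEq n] {ρ' ρ : Matrix n n ℂ}
    (hρ' : ρ'.PosDef) (hρ : ρ.PosDef) :
    ∃ w a b : n × n → ℝ, (∀ p, 0 < a p) ∧ (∀ p, 0 < b p) ∧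
      ρ'.trace.re = ∑ p, w p * a p ∧ ρ.trace.re = ∑ p, w p * b p ∧
      qRelEnt ρ' ρ = ∑ p, w p * (a p * (Real.log (a p) - Real.log (b p))) ∧
      ∀ X : Matrix n n ℂ, X.IsHermitian → ∀ l ∈ Set.Icc (0 : ℝ) 1,
        ((ρ' - ρ) * X).trace.re ^ 2 ≤
          (∑ p, w p * ((a p - b p) ^ 2 / (a p + l * (b p - a p)))) *
          ((1 - l) * (ρ' * (X * X)).trace.re + l * (ρ * (X * X)).trace.re) := by
  obtain ⟨U, hU, hU', a, ha, hρ'e, hlog'⟩ : ∃ U : Matrix n n ℂ, U * Uᴴ = 1 ∧ Uᴴ * U = 1 ∧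
      ∃ a : n → ℝ, (∀ i, 0 < a i) ∧ ρ' = U * diagonal (fun i => (a i : ℂ)) * Uᴴ ∧
      matLog ρ' = U * diagonal (fun i => (Real.log (a i) : ℂ)) * Uᴴ :=
    ⟨hρ'.1.eigenvectorUnitary, Unitary.coe_mul_star_self _, Unitary.coe_star_mul_self _,
      hρ'.1.eigenvalues, hρ'.eigenvalues_pos, spectral_decomposition _, matLog_eq _⟩
  obtain ⟨W, hW, hW', b, hb, hρe, hlog⟩ : ∃ W : Matrix n n ℂ, W * Wᴴ = 1 ∧ Wᴴ * W = 1 ∧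
      ∃ b : n → ℝ, (∀ i, 0 < b i) ∧ ρ = W * diagonal (fun i => (b i : ℂ)) * Wᴴ ∧
      matLog ρ = W * diagonal (fun i => (Real.log (b i) : ℂ)) * Wᴴ :=
    ⟨hρ.1.eigenvectorUnitary, Unitary.coe_mul_star_self _, Unitary.coe_star_mul_self _,
      hρ.1.eigenvalues, hρ.eigenvalues_pos, spectral_decomposition _, matLog_eq _⟩
  have h1 : (1 : Matrix n n ℂ).IsHermitian := Matrix.isHermitian_one
  have hnorm (z : ℂ) : (z * star z).re = Complex.normSq z := by
    simp [Complex.normSq_apply, Complex.mul_re]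
  refine ⟨fun p => Complex.normSq ((Uᴴ * W) p.1 p.2), fun p => a p.1, fun p => b p.2,
    fun p => ha _, fun p => hb _, ?_, ?_, ?_, ?_⟩
  · have := re_trace_left (U := U) hW a 1 h1
    simp only [Matrix.mul_one, hnorm] at this
    rw [hρ'e, this]
    simp only [mul_comm]
  · have := re_trace_right (W := W) hU b h1 1
    simp only [Matrix.mul_one, hnorm] at this
    rw [hρe, this]
    simp only [mul_comm]
  · have hll : (ρ' * matLog ρ').trace.re =
        ∑ p : n × n, a p.1 * Real.log (a p.1) * Complex.normSq ((Uᴴ * W) p.1 p.2) := by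
      have := re_trace_left (U := U) hW (fun i => a i * Real.log (a i)) 1 h1
      simp only [Matrix.mul_one, hnorm] at this
      rw [← this, hlog', hρ'e]
      have h2 : U * diagonal (fun i => (a i : ℂ)) * Uᴴ *
          (U * diagonal (fun i => (Real.log (a i) : ℂ)) * Uᴴ) =
          U * (diagonal (fun i => (a i : ℂ)) * (Uᴴ * U) *
          diagonal (fun i => (Real.log (a i) : ℂ))) * Uᴴ := by
        simp only [Matrix.mul_assoc]
      rw [h2, hU', Matrix.mul_one, Matrix.diagonal_mul_diagonal]
      simp only [Complex.ofReal_mul]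
    have hlr : (ρ' * matLog ρ).trace.re =
        ∑ p : n × n, a p.1 * (Complex.normSq ((Uᴴ * W) p.1 p.2) * Real.log (b p.2)) := by
      have hH : (matLog ρ).IsHermitian := by
        rw [hlog]
        refine Matrix.isHermitian_mul_mul_conjTranspose _ ?_
        refine Matrix.isHermitian_diagonal_of_self_adjoint _ ?_
        ext i
        simp
      have := re_trace_left (U := U) hW a 1 hH
      rw [Matrix.one_mul, ← hρ'e] at this
      rw [this]
      have h2 : Uᴴ * matLog ρ * W = Uᴴ * W * diagonal (fun i => (Real.log (b i) : ℂ)) := by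
        rw [hlog]
        simp only [Matrix.mul_assoc, hW', Matrix.mul_one]
      refine Finset.sum_congr rfl fun p _ => ?_
      rw [h2, Matrix.mul_diagonal, Matrix.mul_one, star_mul', ← mul_assoc, ← hnorm]
      simp [Complex.mul_re]
    rw [qRelEnt, Matrix.mul_sub, Matrix.trace_sub, Complex.sub_re, hll, hlr,
      ← Finset.sum_sub_distrib]
    refine Finset.sum_congr rfl fun p _ => ?_
    ring
  · intro X hX l hl
    have e1 := re_trace_left (U := U) hW a X h1
    have e2 := re_trace_right (W := W) hU b h1 X
    have e3 := re_trace_left (U := U) hW a X hX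
    have e4 := re_trace_right (W := W) hU b hX X
    simp only [Matrix.mul_one, Matrix.one_mul, hnorm, ← hρ'e, ← hρe] at e1 e2 e3 e4
    rw [Matrix.sub_mul, Matrix.trace_sub, Complex.sub_re, e1, e2, e3, e4, Finset.mul_sum,
      Finset.mul_sum, ← Finset.sum_sub_distrib, ← Finset.sum_add_distrib]
    have hc (p : n × n) : 0 < a p.1 + l * (b p.2 - a p.1) :=
      interpolation_pos (ha p.1) (hb p.2) hl
    refine Finset.sum_sq_le_sum_mul_sum_of_sq_le_mul _ (fun p _ => ?_) (fun p _ => ?_)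
      (fun p _ => ?_)
    · exact mul_nonneg (Complex.normSq_nonneg _) (div_nonneg (sq_nonneg _) (hc p).le)
    · have := mul_nonneg (hc p).le (Complex.normSq_nonneg ((Uᴴ * X * W) p.1 p.2))
      linarith
    · have hre : ((Uᴴ * X * W) p.1 p.2 * star ((Uᴴ * W) p.1 p.2)).re ^ 2 ≤
          Complex.normSq ((Uᴴ * X * W) p.1 p.2) * Complex.normSq ((Uᴴ * W) p.1 p.2) := by
        rw [← Complex.normSq_conj ((Uᴴ * W) p.1 p.2), ← Complex.normSq_mul]
        rw [pow_two]
        exact Complex.re_sq_le_normSq _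
      have hc' := (hc p).ne'
      calc _ = (a p.1 - b p.2) ^ 2 *
            ((Uᴴ * X * W) p.1 p.2 * star ((Uᴴ * W) p.1 p.2)).re ^ 2 := by ring
        _ ≤ (a p.1 - b p.2) ^ 2 * (Complex.normSq ((Uᴴ * X * W) p.1 p.2) *
            Complex.normSq ((Uᴴ * W) p.1 p.2)) := mul_le_mul_of_nonneg_left hre (sq_nonneg _)
        _ = _ := by field_simp; ring

lemma continuousOn_interpolation_integrand {a b : ℝ} (ha : 0 < a) (hb : 0 < b) :
    ContinuousOn (fun l : ℝ => l * ((a - b) ^ 2 / (a + l * (b - a)))) (Set.Icc 0 1) := by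
  refine continuousOn_id.mul (continuousOn_const.div (by fun_prop) fun l hl => ?_)
  exact (interpolation_pos ha hb hl).ne'

/-- Integral representation of the scalar relative entropy. -/
lemma integral_interpolation {a b : ℝ} (ha : 0 < a) (hb : 0 < b) :
    ∫ l in (0 : ℝ)..1, l * ((a - b) ^ 2 / (a + l * (b - a))) =
      a * (Real.log a - Real.log b) - a + b := by
  have hd : ∀ l ∈ Set.uIcc (0 : ℝ) 1, HasDerivAt
      (fun l : ℝ => (a + l * (b - a)) - a * Real.log (a + l * (b - a)))
      (l * ((a - b) ^ 2 / (a + l * (b - a)))) l := by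
    intro l hl
    rw [Set.uIcc_of_le zero_le_one] at hl
    have hc := (interpolation_pos ha hb hl).ne'
    have h1 : HasDerivAt (fun l : ℝ => a + l * (b - a)) (b - a) l := by
      simpa using ((hasDerivAt_id l).mul_const (b - a)).const_add a
    refine (h1.sub ((h1.log hc).const_mul a)).congr_deriv ?_
    generalize hcl : a + l * (b - a) = c at hc
    field_simp
    rw [← hcl]
    ring
  have hi : IntervalIntegrable (fun l : ℝ => l * ((a - b) ^ 2 / (a + l * (b - a)))) volume 0 1 :=
    (continuousOn_interpolation_integrand ha hb).intervalIntegrable_of_Icc zero_le_one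
  rw [intervalIntegral.integral_eq_sub_of_hasDerivAt hd hi]
  simp only [one_mul, zero_mul, add_zero, add_sub_cancel]
  ring

lemma Fbound_denom_pos {s l : ℝ} (hs : 0 ≤ s) (hl : l ∈ Set.Icc (0 : ℝ) 1) :
    0 < 1 + l * (1 - l) * s := by
  have := mul_nonneg (mul_nonneg hl.1 (sub_nonneg.2 hl.2)) hs
  linarith

lemma continuousOn_Fbound_integrand {s : ℝ} (hs : 0 ≤ s) :
    ContinuousOn (fun l : ℝ => l * s / (1 + l * (1 - l) * s)) (Set.Icc 0 1) :=
  ContinuousOn.div (by fun_prop) (by fun_prop) fun _ hl => (Fbound_denom_pos hs hl).ne'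

lemma Fbound_strictMonoOn : StrictMonoOn Fbound (Set.Ici 0) := by
  intro s hs t ht hst
  refine intervalIntegral.integral_lt_integral_of_continuousOn_of_le_of_exists_lt one_pos
    (continuousOn_Fbound_integrand hs) (continuousOn_Fbound_integrand ht) (fun l hl => ?_)
    ⟨1, by simp, by simpa using hst⟩
  have hl' := Set.Ioc_subset_Icc_self hl
  rw [div_le_div_iff₀ (Fbound_denom_pos hs hl') (Fbound_denom_pos ht hl')]
  nlinarith [mul_le_mul_of_nonneg_left hst.le hl'.1]

lemma Fbound_le_of_forall_sq_le {ι : Type*} [Fintype ι] {w a b : ι → ℝ} (ha : ∀ p, 0 < a p)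
    (hb : ∀ p, 0 < b p) (hab : ∑ p, w p * a p = ∑ p, w p * b p) {Δ v : ℝ} (hv : 0 < v)
    (h : ∀ l ∈ Set.Icc (0 : ℝ) 1, Δ ^ 2 ≤
      (∑ p, w p * ((a p - b p) ^ 2 / (a p + l * (b p - a p)))) * (v + l * (1 - l) * Δ ^ 2)) :
    Fbound (Δ ^ 2 / v) ≤ ∑ p, w p * (a p * (Real.log (a p) - Real.log (b p))) := by
  have hs : 0 ≤ Δ ^ 2 / v := by positivity
  have hi (p : ι) : IntervalIntegrable
      (fun l : ℝ => w p * (l * ((a p - b p) ^ 2 / (a p + l * (b p - a p))))) volume 0 1 :=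
    ((continuousOn_interpolation_integrand (ha p) (hb p)).intervalIntegrable_of_Icc
      zero_le_one).const_mul _
  have hint : ∑ p, w p * (a p * (Real.log (a p) - Real.log (b p))) =
      ∫ l in (0 : ℝ)..1, ∑ p, w p * (l * ((a p - b p) ^ 2 / (a p + l * (b p - a p)))) := by
    rw [intervalIntegral.integral_finsetSum fun p _ => hi p]
    have hp (p : ι) : ∫ l in (0 : ℝ)..1,
        w p * (l * ((a p - b p) ^ 2 / (a p + l * (b p - a p)))) =
        w p * (a p * (Real.log (a p) - Real.log (b p))) - w p * a p + w p * b p := by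
      rw [intervalIntegral.integral_const_mul, integral_interpolation (ha p) (hb p)]
      ring
    simp only [hp, Finset.sum_add_distrib, Finset.sum_sub_distrib, hab]
    ring
  rw [hint]
  refine intervalIntegral.integral_mono_on zero_le_one
    ((continuousOn_Fbound_integrand hs).intervalIntegrable_of_Icc zero_le_one) ?_ fun l hl => ?_
  · simpa only [Finset.sum_fn] using IntervalIntegrable.sum Finset.univ fun p _ => hi p
  · have hp : 0 < v + l * (1 - l) * Δ ^ 2 := by
      have := mul_nonneg (mul_nonneg hl.1 (sub_nonneg.2 hl.2)) (sq_nonneg Δ)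
      linarith
    have he : l * (Δ ^ 2 / v) / (1 + l * (1 - l) * (Δ ^ 2 / v)) =
        l * (Δ ^ 2 / (v + l * (1 - l) * Δ ^ 2)) := by
      have := Fbound_denom_pos hs hl
      field_simp
    simp only [mul_left_comm (w _) l, ← Finset.mul_sum]
    rw [he]
    exact mul_le_mul_of_nonneg_left ((div_le_iff₀ hp).2 (h l hl)) hl.1

/-- Second moment of an observable about an arbitrary point. -/
lemma re_trace_sub_smul_sq {n : Type*} [Fintype n] [DecidableEq n] {ρ : Matrix n n ℂ}
    (hρ : ρ.trace = 1) (Y : Matrix n n ℂ) (c : ℝ) :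
    (ρ * ((Y - (c : ℂ) • 1) * (Y - (c : ℂ) • 1))).trace.re =
      (ρ * (centered ρ Y * centered ρ Y)).trace.re + ((ρ * Y).trace.re - c) ^ 2 := by
  have key (c : ℝ) : (ρ * ((Y - (c : ℂ) • 1) * (Y - (c : ℂ) • 1))).trace.re =
      (ρ * (Y * Y)).trace.re - 2 * c * (ρ * Y).trace.re + c ^ 2 := by
    simp [Matrix.mul_sub, Matrix.sub_mul, hρ]
    ring
  rw [centered, key, key]
  ring

/-- Scalar quantum thermodynamic uncertainty relation. -/
lemma Fbound_le_qRelEnt {n : Type*} [Fintype n] [DecidableEq n] {ρ' ρ : Matrix n n ℂ}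
    (hρ' : ρ'.PosDef) (hρ : ρ.PosDef) (hρ'tr : ρ'.trace = 1) (hρtr : ρ.trace = 1)
    {Y : Matrix n n ℂ} (hY : Y.IsHermitian) {v : ℝ} (hv : 0 < v)
    (hvρ' : (ρ' * (centered ρ' Y * centered ρ' Y)).trace.re = v)
    (hvρ : (ρ * (centered ρ Y * centered ρ Y)).trace.re = v) :
    Fbound (((ρ' - ρ) * Y).trace.re ^ 2 / v) ≤ qRelEnt ρ' ρ := by
  obtain ⟨w, a, b, ha, hb, hwa, hwb, hD, hCS⟩ := exists_joint_distribution hρ' hρ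
  rw [hD]
  refine Fbound_le_of_forall_sq_le ha hb (by rw [← hwa, ← hwb, hρ'tr, hρtr]) hv fun l hl => ?_
  set c : ℝ := (1 - l) * (ρ' * Y).trace.re + l * (ρ * Y).trace.re with hc
  have hX : (Y - (c : ℂ) • 1).IsHermitian := by
    refine hY.sub ?_
    simp [Matrix.IsHermitian, Matrix.conjTranspose_smul]
  have h := hCS _ hX l hl
  rw [re_trace_sub_smul_sq hρ'tr, re_trace_sub_smul_sq hρtr, hvρ', hvρ] at h
  have h1 : ((ρ' - ρ) * (Y - (c : ℂ) • 1)).trace = ((ρ' - ρ) * Y).trace := by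
    simp [Matrix.mul_sub, hρ'tr, hρtr]
  rw [h1] at h
  refine h.trans_eq ?_
  rw [Matrix.sub_mul, Matrix.trace_sub, Complex.sub_re, hc]
  ring

lemma centered_sum_smul {n : Type*} [Fintype n] [DecidableEq n] {m : ℕ} (ρ : Matrix n n ℂ)
    (Q : Fin m → Matrix n n ℂ) (x : Fin m → ℝ) :
    centered ρ (∑ u, (x u : ℂ) • Q u) = ∑ u, (x u : ℂ) • centered ρ (Q u) := by
  simp only [centered, smul_sub, Finset.sum_sub_distrib, Matrix.mul_sum, Matrix.trace_sum,
    Matrix.mul_smul, Matrix.trace_smul, Complex.re_sum, smul_eq_mul, Complex.re_ofReal_mul,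
    smul_smul, Complex.ofReal_sum, Complex.ofReal_mul, Finset.sum_smul]

/-- The covariance quadratic form is the variance of the corresponding linear combination. -/
lemma dotProduct_covMatrix_mulVec {n : Type*} [Fintype n] [DecidableEq n] {m : ℕ}
    (ρ : Matrix n n ℂ) (Q : Fin m → Matrix n n ℂ) (x : Fin m → ℝ) :
    x ⬝ᵥ (covMatrix ρ Q *ᵥ x) =
      (ρ * (centered ρ (∑ u, (x u : ℂ) • Q u) * centered ρ (∑ u, (x u : ℂ) • Q u))).trace.re := by
  set g : Fin m → Fin m → ℝ := fun u v => (ρ * (centered ρ (Q u) * centered ρ (Q v))).trace.re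
    with hg
  have hR : (ρ * (centered ρ (∑ u, (x u : ℂ) • Q u) *
      centered ρ (∑ u, (x u : ℂ) • Q u))).trace.re = ∑ u, ∑ v, x u * x v * g u v := by
    rw [centered_sum_smul]
    simp only [Finset.sum_mul_sum, Matrix.mul_sum, Matrix.trace_sum, Complex.re_sum,
      Matrix.smul_mul, Matrix.mul_smul, Matrix.trace_smul, smul_eq_mul, Complex.re_ofReal_mul, hg]
    refine Finset.sum_congr rfl fun u _ => Finset.sum_congr rfl fun v _ => ?_
    ring
  have hL : x ⬝ᵥ (covMatrix ρ Q *ᵥ x) =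
      1 / 2 * (∑ u, ∑ v, x u * x v * g u v + ∑ u, ∑ v, x u * x v * g v u) := by
    simp only [dotProduct, Matrix.mulVec, covMatrix, Matrix.of_apply, Matrix.mul_add,
      Matrix.trace_add, Complex.add_re, Finset.mul_sum, ← Finset.sum_add_distrib, hg]
    refine Finset.sum_congr rfl fun u _ => Finset.sum_congr rfl fun v _ => ?_
    ring
  have hS : ∑ u, ∑ v, x u * x v * g v u = ∑ u, ∑ v, x u * x v * g u v := by
    rw [Finset.sum_comm]
    simp only [mul_comm (x _) (x _)]
  rw [hL, hR, hS]
  ring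

/-- Matrix symmetric quantum TUR: if `V' = V` is positive definite,
`t > 0` and `D(ρ'‖ρ) ≤ F(t)`, then `V − t⁻¹ Δq Δqᵀ ⪰ 0`. -/
theorem matrix_symmetric_quantum_TUR
    (d m : ℕ) (hd : 0 < d) (hm : 0 < m)
    (ρ' ρ : Matrix (Fin d) (Fin d) ℂ)
    (hρ' : ρ'.PosDef) (hρ : ρ.PosDef)
    (hρ'tr : ρ'.trace = 1) (hρtr : ρ.trace = 1)
    (Q : Fin m → Matrix (Fin d) (Fin d) ℂ) (hQ : ∀ u, (Q u).IsHermitian)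
    (Δq : Fin m → ℝ)
    (hΔq : ∀ u, Δq u = (Matrix.trace ((ρ' - ρ) * Q u)).re)
    (V V' : Matrix (Fin m) (Fin m) ℝ)
    (hV : V = covMatrix ρ Q) (hV' : V' = covMatrix ρ' Q)
    (hsym : V' = V) (hVpd : V.PosDef)
    (t : ℝ) (ht : 0 < t)
    (hD : qRelEnt ρ' ρ ≤ Fbound t) :
    (V - t⁻¹ • Matrix.vecMulVec Δq Δq).PosSemidef := by
  refine Matrix.PosSemidef.of_dotProduct_mulVec_nonneg ?_ fun x => ?_
  · refine hVpd.1.sub ?_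
    ext u v
    simp [Matrix.vecMulVec_apply, mul_comm]
  · have hform : star x ⬝ᵥ ((V - t⁻¹ • Matrix.vecMulVec Δq Δq) *ᵥ x) =
        x ⬝ᵥ (V *ᵥ x) - t⁻¹ * (Δq ⬝ᵥ x) ^ 2 := by
      simp only [star_trivial, Matrix.sub_mulVec, Matrix.smul_mulVec, dotProduct_sub,
        Matrix.vecMulVec_mulVec, dotProduct_smul, smul_eq_mul, MulOpposite.smul_eq_mul_unop,
        MulOpposite.unop_op, dotProduct_comm x Δq]
      ring
    rw [hform]
    by_cases hx : x = 0
    · simp [hx]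
    have hv : 0 < x ⬝ᵥ (V *ᵥ x) := by simpa using hVpd.dotProduct_mulVec_pos hx
    set Y : Matrix (Fin d) (Fin d) ℂ := ∑ u, (x u : ℂ) • Q u with hYdef
    have hY : Y.IsHermitian := by
      simp [Matrix.IsHermitian, hYdef, Matrix.conjTranspose_sum, Matrix.conjTranspose_smul,
        fun u => (hQ u).eq]
    have hΔ : ((ρ' - ρ) * Y).trace.re = Δq ⬝ᵥ x := by
      simp only [hYdef, Matrix.mul_sum, Matrix.trace_sum, Complex.re_sum, Matrix.mul_smul,
        Matrix.trace_smul, smul_eq_mul, Complex.re_ofReal_mul, dotProduct, hΔq, mul_comm]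
    have hF := Fbound_le_qRelEnt hρ' hρ hρ'tr hρtr hY hv
      (by rw [← dotProduct_covMatrix_mulVec, ← hV', hsym])
      (by rw [← dotProduct_covMatrix_mulVec, ← hV])
    rw [hΔ] at hF
    have hle : (Δq ⬝ᵥ x) ^ 2 / (x ⬝ᵥ (V *ᵥ x)) ≤ t :=
      (Fbound_strictMonoOn.le_iff_le (Set.mem_Ici.2 (by positivity)) ht.le).1 (hF.trans hD)
    rw [div_le_iff₀ hv] at hle
    rw [sub_nonneg, inv_mul_le_iff₀ ht]
    exact hle
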